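/- Regularity and polynomial estimates for the kernel Φ: for w in W = {Re z > 0} and x, y ≥ 0 let Φ(x,y,w) = ∫₀^∞ (sin kx / k)·(sin ky / k)·( √(k²+w) − k )·(2k/π) dk (principal branch of the square root). Then: (i) Φ is continuous in (x,y) ∈ [0,∞)² and holomorphic in w ∈ W; (ii) for every X ≥ 1 the map x ↦ Φ(x,·,w) ∈ L²([0,X]) is continuously differentiable; (iii) the map x ↦ Φ(x,x,w) is continuously differentiable on [0,∞); (iv) there exist a constant C(X) and an exponent α independent of X such that sup_{x,y ∈ [0,X]} |Φ(x,y,w)| ≤ C(X)(1+|w|)^α, sup_{x ≤ X} ‖(∂Φ/∂x)(x,·,w)‖_{L²([0,X])} ≤ C(X)(1+|w|)^α, and sup_{x ≤ X} |d/dx Φ(x,x,w)| ≤ C(X)(1+|w|)^α. -/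

import Mathlib

open MeasureTheory Set

noncomputable section

/-- The kernel `Φ(x,y,w) = ∫₀^∞ (sin kx / k)(sin ky / k)(√(k²+w) − k)(2k/π) dk`
(principal branch of the complex square root). -/
def Phi (x y : ℝ) (w : ℂ) : ℂ :=
  ∫ k in Ioi (0:ℝ),
    ((Real.sin (k * x) / k : ℝ) : ℂ) * ((Real.sin (k * y) / k : ℝ) : ℂ) *
      (((k : ℂ) ^ 2 + w) ^ ((1 : ℂ) / 2) - (k : ℂ)) * ((2 * k / Real.pi : ℝ) : ℂ)

def qq (w : ℂ) (k : ℝ) : ℂ := ((k : ℂ) ^ 2 + w) ^ ((1 : ℂ) / 2)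
def mm (w : ℂ) (k : ℝ) : ℂ := qq w k - k
def rr (w : ℂ) (k : ℝ) : ℂ := mm w k - w / (2 * k)
def RR (w : ℂ) (t : ℝ) : ℂ := ∫ k in Ioi (0:ℝ), ((1 - Real.cos (k * t) : ℝ) : ℂ) * (rr w k / k)
def RD (w : ℂ) (t : ℝ) : ℂ := ∫ k in Ioi (0:ℝ), ((Real.sin (k * t) : ℝ) : ℂ) * rr w k
def cc : ℝ := ∫ k in Ioi (0:ℝ), (1 - Real.cos k) / k ^ 2
def ff (w : ℂ) (t : ℝ) : ℂ := w / 2 * cc * (|t| : ℝ) + RR w t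
def KK : ℝ := ∫ k in Ioi (0:ℝ), (1 + k ^ 2)⁻¹

lemma KK_nonneg : 0 ≤ KK := by
  unfold KK
  exact integral_nonneg fun k => by positivity

lemma intK (c : ℝ) : Integrable (fun k : ℝ => c * (1 + k ^ 2)⁻¹) (volume.restrict (Ioi 0)) :=
  (integrable_inv_one_add_sq.const_mul c).restrict

lemma qq_sq (w : ℂ) (k : ℝ) : qq w k ^ 2 = (k : ℂ) ^ 2 + w := by
  unfold qq
  rw [one_div]
  exact Complex.cpow_ofNat_inv_pow _ 2

lemma qq_re_nonneg (w : ℂ) (hw : 0 < w.re) (k : ℝ) : 0 ≤ (qq w k).re := by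
  unfold qq
  have h0 : (k : ℂ) ^ 2 + w ≠ 0 := by
    intro h
    have := congrArg Complex.re h
    simp [← Complex.ofReal_pow] at this
    nlinarith [sq_nonneg k]
  rw [Complex.cpow_def_of_ne_zero h0, Complex.exp_re]
  apply mul_nonneg (Real.exp_pos _).le
  have h1 := Complex.abs_arg_le_pi ((k : ℂ) ^ 2 + w)
  rw [abs_le] at h1
  have e : (Complex.log ((k : ℂ) ^ 2 + w) * (1 / 2)).im = ((k : ℂ) ^ 2 + w).arg / 2 := by
    rw [show (1 / 2 : ℂ) = ((1 / 2 : ℝ) : ℂ) by push_cast; rfl, Complex.im_mul_ofReal, Complex.log_im]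
    ring
  rw [e]
  apply Real.cos_nonneg_of_neg_pi_div_two_le_of_le <;> linarith [h1.1, h1.2]

lemma qq_re (w : ℂ) (hw : 0 < w.re) (k : ℝ) : k ≤ (qq w k).re := by
  have h := congrArg Complex.re (qq_sq w k)
  rw [pow_two, pow_two, Complex.mul_re, Complex.add_re, ← Complex.ofReal_mul, Complex.ofReal_re] at h
  have := qq_re_nonneg w hw k
  nlinarith [mul_self_nonneg (qq w k).im]

lemma mm_mul (w : ℂ) (k : ℝ) : mm w k * (k + qq w k) = w := by
  have := qq_sq w k
  unfold mm
  linear_combination this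

lemma mm_bound (w : ℂ) (hw : 0 < w.re) (k : ℝ) (hk : 0 < k) : ‖mm w k‖ * (2 * k) ≤ ‖w‖ := by
  have h1 : 2 * k ≤ ‖(k : ℂ) + qq w k‖ := by
    refine le_trans ?_ (Complex.re_le_norm _)
    have := qq_re w hw k
    simp; linarith
  calc ‖mm w k‖ * (2 * k) ≤ ‖mm w k‖ * ‖(k : ℂ) + qq w k‖ := by gcongr
    _ = ‖w‖ := by rw [← norm_mul, mm_mul]

lemma rr_eq (w : ℂ) (k : ℝ) (hk : 0 < k) : rr w k * (2 * k) = - mm w k ^ 2 := by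
  have hk' : (k : ℂ) ≠ 0 := by exact_mod_cast hk.ne'
  have h := mm_mul w k
  have h2 : rr w k * (2 * k) = mm w k * (2 * k) - w := by
    unfold rr; field_simp
  rw [h2]
  have h3 : qq w k = mm w k + k := by unfold mm; ring
  rw [h3] at h
  linear_combination h

lemma rr_bound (w : ℂ) (hw : 0 < w.re) (k : ℝ) (hk : 0 < k) :
    ‖rr w k‖ * k ≤ (1 + ‖w‖) ^ 2 * (1 + k ^ 2)⁻¹ := by
  have h1 := mm_bound w hw k hk
  have h2 : ‖rr w k‖ * (2 * k) = ‖mm w k‖ ^ 2 := by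
    have := congrArg norm (rr_eq w k hk)
    simpa [abs_of_pos hk] using this
  have h3 : ‖rr w k‖ * (2 * k) ≤ 2 * ‖w‖ := by
    have : rr w k * (2 * k) = mm w k * (2 * k) - w := by
      have hk' : (k : ℂ) ≠ 0 := by exact_mod_cast hk.ne'
      unfold rr; field_simp
    have h4 := congrArg norm this
    have h5 := norm_sub_le (mm w k * (2 * k)) w
    simp [abs_of_pos hk] at h4 h5
    linarith
  rw [← div_eq_mul_inv, le_div_iff₀ (by positivity)]
  have h0 := norm_nonneg w
  have h4 : (‖mm w k‖ * (2 * k)) ^ 2 ≤ ‖w‖ ^ 2 := by gcongr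
  have h5 : ‖rr w k‖ * k * k ^ 2 * 8 ≤ ‖w‖ ^ 2 := by
    calc ‖rr w k‖ * k * k ^ 2 * 8 = (‖rr w k‖ * (2 * k)) * (4 * k ^ 2) := by ring
      _ = (‖mm w k‖ * (2 * k)) ^ 2 := by rw [h2]; ring
      _ ≤ _ := h4
  nlinarith

lemma qq_meas (w : ℂ) : Measurable (qq w) := by
  unfold qq; fun_prop
lemma mm_meas (w : ℂ) : Measurable (mm w) := by
  unfold mm; have := qq_meas w; fun_prop
lemma rr_meas (w : ℂ) : Measurable (rr w) := by
  unfold rr; have := mm_meas w; fun_prop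

lemma onecos_bound (k t : ℝ) (hk : 0 < k) :
    |(1 - Real.cos (k * t)) / k ^ 2| ≤ (2 + t ^ 2) * (1 + k ^ 2)⁻¹ := by
  have h1 := Real.one_sub_sq_div_two_le_cos (x := k * t)
  have h2 := Real.neg_one_le_cos (k * t)
  have h3 := Real.cos_le_one (k * t)
  rw [abs_of_nonneg (by apply div_nonneg <;> nlinarith [sq_nonneg k]), ← div_eq_mul_inv,
    div_le_div_iff₀ (by positivity) (by positivity)]
  have : (1 - Real.cos (k * t)) * k ^ 2 ≤ 2 * k ^ 2 := by gcongr; linarith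
  nlinarith [sq_nonneg (k * t)]

lemma onecos_le (k t : ℝ) : |1 - Real.cos (k * t)| ≤ (k * t) ^ 2 := by
  have h1 := Real.one_sub_sq_div_two_le_cos (x := k * t)
  have h3 := Real.cos_le_one (k * t)
  rw [abs_of_nonneg (by linarith)]
  nlinarith [sq_nonneg (k * t)]

lemma RR_bound (w : ℂ) (hw : 0 < w.re) (t k : ℝ) (hk : 0 < k) :
    ‖((1 - Real.cos (k * t) : ℝ) : ℂ) * (rr w k / k)‖ ≤ (t ^ 2 * (1 + ‖w‖) ^ 2) * (1 + k ^ 2)⁻¹ := by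
  rw [norm_mul, norm_div, Complex.norm_real, Complex.norm_real, Real.norm_eq_abs, Real.norm_eq_abs,
    abs_of_pos hk]
  calc _ ≤ (k * t) ^ 2 * (‖rr w k‖ / k) := by gcongr; exact onecos_le k t
    _ = t ^ 2 * (‖rr w k‖ * k) := by field_simp
    _ ≤ t ^ 2 * ((1 + ‖w‖) ^ 2 * (1 + k ^ 2)⁻¹) :=
      mul_le_mul_of_nonneg_left (rr_bound w hw k hk) (sq_nonneg t)
    _ = _ := by ring

lemma RD_bound (w : ℂ) (hw : 0 < w.re) (t k : ℝ) (hk : 0 < k) :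
    ‖((Real.sin (k * t) : ℝ) : ℂ) * rr w k‖ ≤ (|t| * (1 + ‖w‖) ^ 2) * (1 + k ^ 2)⁻¹ := by
  rw [norm_mul, Complex.norm_real, Real.norm_eq_abs]
  calc _ ≤ |k * t| * ‖rr w k‖ :=
      mul_le_mul_of_nonneg_right Real.abs_sin_le_abs (norm_nonneg _)
    _ = |t| * (‖rr w k‖ * k) := by rw [abs_mul, abs_of_pos hk]; ring
    _ ≤ |t| * ((1 + ‖w‖) ^ 2 * (1 + k ^ 2)⁻¹) :=
      mul_le_mul_of_nonneg_left (rr_bound w hw k hk) (abs_nonneg t)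
    _ = _ := by ring

lemma ae_Ioi {p : ℝ → Prop} (h : ∀ k, 0 < k → p k) : ∀ᵐ k ∂(volume.restrict (Ioi (0:ℝ))), p k :=
  (ae_restrict_iff' measurableSet_Ioi).2 (Filter.Eventually.of_forall h)

lemma RR_meas (w : ℂ) (t : ℝ) :
    AEStronglyMeasurable (fun k : ℝ => ((1 - Real.cos (k * t) : ℝ) : ℂ) * (rr w k / k))
      (volume.restrict (Ioi 0)) := by
  have := rr_meas w
  apply Measurable.aestronglyMeasurable
  fun_prop

lemma RD_meas (w : ℂ) (t : ℝ) :
    AEStronglyMeasurable (fun k : ℝ => ((Real.sin (k * t) : ℝ) : ℂ) * rr w k)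
      (volume.restrict (Ioi 0)) := by
  have := rr_meas w
  apply Measurable.aestronglyMeasurable
  fun_prop

lemma RR_int (w : ℂ) (hw : 0 < w.re) (t : ℝ) :
    Integrable (fun k : ℝ => ((1 - Real.cos (k * t) : ℝ) : ℂ) * (rr w k / k))
      (volume.restrict (Ioi 0)) :=
  (intK _).mono' (RR_meas w t) (ae_Ioi fun k hk => RR_bound w hw t k hk)

lemma RD_norm (w : ℂ) (hw : 0 < w.re) (t : ℝ) : ‖RD w t‖ ≤ |t| * (1 + ‖w‖) ^ 2 * KK := by
  unfold RD KK
  rw [← integral_const_mul]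
  exact norm_integral_le_of_norm_le (intK _) (ae_Ioi fun k hk => RD_bound w hw t k hk)

lemma RD_cont (w : ℂ) (hw : 0 < w.re) : Continuous (RD w) := by
  rw [continuous_iff_continuousAt]
  intro t
  apply continuousAt_of_dominated (bound := fun k => ((|t| + 1) * (1 + ‖w‖) ^ 2) * (1 + k ^ 2)⁻¹)
  · exact Filter.Eventually.of_forall (RD_meas w)
  · filter_upwards [Metric.ball_mem_nhds t one_pos] with s hs
    refine ae_Ioi fun k hk => (RD_bound w hw s k hk).trans ?_
    gcongr
    rw [Metric.mem_ball, Real.dist_eq] at hs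
    have := abs_sub_abs_le_abs_sub s t
    linarith
  · exact intK _
  · exact ae_Ioi fun k hk => by fun_prop

lemma RR_deriv (w : ℂ) (hw : 0 < w.re) (t : ℝ) : HasDerivAt (RR w) (RD w t) t := by
  refine (hasDerivAt_integral_of_dominated_loc_of_deriv_le (F := fun t k => ((1 - Real.cos (k * t) : ℝ) : ℂ) * (rr w k / k)) (F' := fun t k => ((Real.sin (k * t) : ℝ) : ℂ) * rr w k)
    (bound := fun k => ((|t| + 1) * (1 + ‖w‖) ^ 2) * (1 + k ^ 2)⁻¹)
    (Metric.ball_mem_nhds t one_pos) ?_ (RR_int w hw t) (RD_meas w t) ?_ (intK _) ?_).2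
  · exact Filter.Eventually.of_forall (RR_meas w)
  · refine ae_Ioi fun k hk s hs => (RD_bound w hw s k hk).trans ?_
    gcongr
    rw [Metric.mem_ball, Real.dist_eq] at hs
    have := abs_sub_abs_le_abs_sub s t
    linarith
  · refine ae_Ioi fun k hk s hs => ?_
    have h1 : HasDerivAt (fun s : ℝ => 1 - Real.cos (k * s)) (Real.sin (k * s) * k) s := by
      have := (((hasDerivAt_id s).const_mul k).cos).const_sub 1
      simpa using this
    have h2 := (h1.ofReal_comp).mul_const (rr w k / k)
    refine h2.congr_deriv ?_
    have hk' : (k : ℂ) ≠ 0 := by exact_mod_cast hk.ne'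
    rw [Complex.ofReal_mul]
    field_simp

lemma cc_scale (t : ℝ) : ∫ k in Ioi (0:ℝ), (1 - Real.cos (k * t)) / k ^ 2 = cc * |t| := by
  rcases eq_or_ne t 0 with rfl | ht
  · simp
  have hb : 0 < |t| := abs_pos.2 ht
  have h := integral_comp_mul_left_Ioi (fun u : ℝ => (1 - Real.cos u) / u ^ 2) 0 hb
  rw [mul_zero] at h
  have e : ∀ k : ℝ, (1 - Real.cos (k * t)) / k ^ 2 =
      |t| ^ 2 * ((1 - Real.cos (|t| * k)) / (|t| * k) ^ 2) := by
    intro k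
    have : Real.cos (|t| * k) = Real.cos (k * t) := by
      rw [← Real.cos_abs (k * t), ← Real.cos_abs (|t| * k), abs_mul, abs_mul, abs_abs, mul_comm]
    rw [this, mul_pow]
    field_simp
  simp_rw [e]
  rw [integral_const_mul, h]
  unfold cc
  rw [smul_eq_mul]
  field_simp

lemma onecos_int (t : ℝ) : Integrable (fun k : ℝ => (1 - Real.cos (k * t)) / k ^ 2)
    (volume.restrict (Ioi 0)) := by
  refine (intK (2 + t ^ 2)).mono' ?_ (ae_Ioi fun k hk => onecos_bound k t hk)
  apply Measurable.aestronglyMeasurable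
  fun_prop

lemma ff_int (w : ℂ) (hw : 0 < w.re) (t : ℝ) :
    Integrable (fun k : ℝ => ((1 - Real.cos (k * t) : ℝ) : ℂ) * (mm w k / k))
      (volume.restrict (Ioi 0)) ∧
    ∫ k in Ioi (0:ℝ), ((1 - Real.cos (k * t) : ℝ) : ℂ) * (mm w k / k) = ff w t := by
  have h1 : Integrable (fun k : ℝ => w / 2 * (((1 - Real.cos (k * t)) / k ^ 2 : ℝ) : ℂ))
      (volume.restrict (Ioi 0)) := ((onecos_int t).ofReal (𝕜 := ℂ)).const_mul (w / 2)
  have h2 := RR_int w hw t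
  have e : ∀ k ∈ Ioi (0:ℝ), ((1 - Real.cos (k * t) : ℝ) : ℂ) * (mm w k / k) =
     w / 2 * (((1 - Real.cos (k * t)) / k ^ 2 : ℝ) : ℂ) + ((1 - Real.cos (k * t) : ℝ) : ℂ) * (rr w k / k) := by
    intro k hk
    have hk' : (k : ℂ) ≠ 0 := by exact_mod_cast (ne_of_gt hk)
    unfold rr
    push_cast
    field_simp
    ring
  constructor
  · exact (h1.add h2).congr (ae_Ioi fun k hk => (e k hk).symm)
  · rw [setIntegral_congr_fun measurableSet_Ioi e]
    rw [integral_add h1 h2, integral_const_mul, integral_complex_ofReal, cc_scale]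
    unfold ff RR
    push_cast
    ring

lemma Phi_eq (w : ℂ) (hw : 0 < w.re) (x y : ℝ) :
    Phi x y w = (Real.pi : ℂ)⁻¹ * (ff w (x + y) - ff w (x - y)) := by
  rw [← (ff_int w hw (x + y)).2, ← (ff_int w hw (x - y)).2,
    ← integral_sub (ff_int w hw (x + y)).1 (ff_int w hw (x - y)).1, ← integral_const_mul]
  unfold Phi
  refine setIntegral_congr_fun measurableSet_Ioi fun k hk => ?_
  have hk' : (k : ℂ) ≠ 0 := by exact_mod_cast (ne_of_gt hk)
  have hp : (Real.pi : ℂ) ≠ 0 := by exact_mod_cast Real.pi_ne_zero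
  simp only [mm, qq]
  rw [mul_add k x y, mul_sub k x y, Real.cos_add, Real.cos_sub]
  push_cast
  field_simp
  ring

lemma sinsin (x y k : ℝ) (hk : 0 < k) :
    |Real.sin (k * x) / k * (Real.sin (k * y) / k)| ≤ (1 + |x| * |y|) * (1 + k ^ 2)⁻¹ := by
  have a1 := Real.abs_sin_le_one (k * x)
  have a2 := Real.abs_sin_le_one (k * y)
  have b1 := Real.abs_sin_le_abs (x := k * x)
  have b2 := Real.abs_sin_le_abs (x := k * y)
  have e : |Real.sin (k * x) / k * (Real.sin (k * y) / k)| =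
      |Real.sin (k * x)| * |Real.sin (k * y)| / k ^ 2 := by
    rw [abs_mul, abs_div, abs_div, abs_of_pos hk]; field_simp
  rw [e, ← div_eq_mul_inv, div_le_div_iff₀ (by positivity) (by positivity)]
  have c1 : |Real.sin (k * x)| * |Real.sin (k * y)| ≤ 1 :=
    mul_le_one₀ a1 (abs_nonneg _) a2
  have c2 : |Real.sin (k * x)| * |Real.sin (k * y)| ≤ |k * x| * |k * y| := by gcongr
  rw [abs_mul, abs_mul, abs_of_pos hk] at c2
  nlinarith [sq_nonneg k, mul_le_mul_of_nonneg_right c1 (sq_nonneg k)]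

lemma two_div_pi : 2 / Real.pi ≤ 1 := by
  rw [div_le_one Real.pi_pos]; linarith [Real.pi_gt_three]

lemma Phi_bound (w : ℂ) (hw : 0 < w.re) (x y k : ℝ) (hk : 0 < k) :
    ‖((Real.sin (k * x) / k : ℝ) : ℂ) * ((Real.sin (k * y) / k : ℝ) : ℂ) *
      (((k : ℂ) ^ 2 + w) ^ ((1 : ℂ) / 2) - (k : ℂ)) * ((2 * k / Real.pi : ℝ) : ℂ)‖ ≤
      ((1 + |x| * |y|) * ‖w‖) * (1 + k ^ 2)⁻¹ := by
  rw [← Complex.ofReal_mul, norm_mul, norm_mul, Complex.norm_real, Complex.norm_real,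
    Real.norm_eq_abs, Real.norm_eq_abs]
  have h := mm_bound w hw k hk
  have h1 := sinsin x y k hk
  change _ * ‖mm w k‖ * _ ≤ _
  have h2 : |2 * k / Real.pi| ≤ 2 * k := by
    rw [abs_of_pos (by positivity)]
    apply div_le_self (by positivity)
    linarith [Real.pi_gt_three]
  calc _ ≤ ((1 + |x| * |y|) * (1 + k ^ 2)⁻¹) * ‖mm w k‖ * (2 * k) := by gcongr
    _ = ((1 + |x| * |y|) * (1 + k ^ 2)⁻¹) * (‖mm w k‖ * (2 * k)) := by ring
    _ ≤ ((1 + |x| * |y|) * (1 + k ^ 2)⁻¹) * ‖w‖ := by gcongr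
    _ = _ := by ring

lemma Phi_norm (w : ℂ) (hw : 0 < w.re) (x y : ℝ) :
    ‖Phi x y w‖ ≤ (1 + |x| * |y|) * ‖w‖ * KK := by
  unfold Phi KK
  rw [← integral_const_mul]
  exact norm_integral_le_of_norm_le (intK _) (ae_Ioi fun k hk => Phi_bound w hw x y k hk)

lemma Phi_diff (w : ℂ) (hw : 0 < w.re) (x y : ℝ) :
    DifferentiableAt ℂ (fun w => Phi x y w) w := by
  have hmeas : ∀ w : ℂ, AEStronglyMeasurable (fun k : ℝ => ((Real.sin (k * x) / k : ℝ) : ℂ) * ((Real.sin (k * y) / k : ℝ) : ℂ) *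
      (((k : ℂ) ^ 2 + w) ^ ((1 : ℂ) / 2) - (k : ℂ)) * ((2 * k / Real.pi : ℝ) : ℂ)) (volume.restrict (Ioi 0)) := by
    intro w
    apply Measurable.aestronglyMeasurable
    fun_prop
  refine (hasDerivAt_integral_of_dominated_loc_of_deriv_le
    (F := fun (w : ℂ) (k : ℝ) => ((Real.sin (k * x) / k : ℝ) : ℂ) * ((Real.sin (k * y) / k : ℝ) : ℂ) *
      (((k : ℂ) ^ 2 + w) ^ ((1 : ℂ) / 2) - (k : ℂ)) * ((2 * k / Real.pi : ℝ) : ℂ))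
    (F' := fun (w : ℂ) (k : ℝ) => ((Real.sin (k * x) / k : ℝ) : ℂ) * ((Real.sin (k * y) / k : ℝ) : ℂ) *
      (1 / (2 * qq w k)) * ((2 * k / Real.pi : ℝ) : ℂ))
    (s := {w : ℂ | 0 < w.re})
    (bound := fun k => (1 + |x| * |y|) * (1 + k ^ 2)⁻¹)
    ?_ ?_ ?_ ?_ ?_ (intK _) ?_).2.differentiableAt
  · exact (isOpen_lt continuous_const Complex.continuous_re).mem_nhds hw
  · exact Filter.Eventually.of_forall hmeas
  · exact (intK _).mono' (hmeas w) (ae_Ioi fun k hk => Phi_bound w hw x y k hk)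
  · apply Measurable.aestronglyMeasurable
    have := qq_meas w
    fun_prop
  · refine ae_Ioi fun k hk z hz => ?_
    rw [← Complex.ofReal_mul, norm_mul, norm_mul, Complex.norm_real, Complex.norm_real,
      Real.norm_eq_abs, Real.norm_eq_abs]
    have h1 := sinsin x y k hk
    have h2 : |2 * k / Real.pi| ≤ 2 * k := by
      rw [abs_of_pos (by positivity)]
      apply div_le_self (by positivity)
      linarith [Real.pi_gt_three]
    have h3 : k ≤ ‖qq z k‖ := (qq_re z hz k).trans (Complex.re_le_norm _)
    have h4 : ‖1 / (2 * qq z k)‖ ≤ 1 / (2 * k) := by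
      rw [norm_div, norm_one, norm_mul]
      simp only [Complex.norm_ofNat]
      gcongr
    calc _ ≤ ((1 + |x| * |y|) * (1 + k ^ 2)⁻¹) * (1 / (2 * k)) * (2 * k) := by gcongr
      _ = _ := by field_simp
  · refine ae_Ioi fun k hk z hz => ?_
    have hs : (k : ℂ) ^ 2 + z ∈ Complex.slitPlane := by
      left
      rw [← Complex.ofReal_pow]
      have : 0 < z.re := hz
      rw [Complex.add_re, Complex.ofReal_re]
      positivity
    have h1 : HasDerivAt (fun z : ℂ => ((k : ℂ) ^ 2 + z) ^ ((1 : ℂ) / 2)) (1 / (2 * qq z k)) z := by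
      have h := ((hasDerivAt_id z).const_add ((k : ℂ) ^ 2)).cpow_const (c := (1 : ℂ) / 2) hs
      refine h.congr_deriv ?_
      have hq : qq z k ≠ 0 := by
        intro h0
        have := qq_re z hz k
        rw [h0] at this
        simp at this
        linarith
      have hne := Complex.slitPlane_ne_zero hs
      simp only [id]
      rw [Complex.cpow_sub _ _ hne, Complex.cpow_one]
      change 1 / 2 * (qq z k / _) * 1 = _
      rw [← qq_sq]
      field_simp
    exact ((h1.sub_const (k : ℂ)).const_mul _).mul_const _

lemma L2_tendsto {μ : Measure ℝ} [IsFiniteMeasure μ] {l : Filter ℝ} [l.IsCountablyGenerated]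
    (φ : ℝ → ℝ → ℂ) (ψ : ℝ → ℂ) (hφ : ∀ x, MemLp (φ x) 2 μ) (hψ : MemLp ψ 2 μ) (B : ℝ)
    (hb : ∀ᶠ x in l, ∀ᵐ y ∂μ, ‖φ x y - ψ y‖ ≤ B)
    (hlim : ∀ᵐ y ∂μ, Filter.Tendsto (fun x => φ x y) l (nhds (ψ y))) :
    Filter.Tendsto (fun x => (hφ x).toLp (φ x)) l (nhds (hψ.toLp ψ)) := by
  rw [Lp.tendsto_Lp_iff_tendsto_eLpNorm'']
  have e : ∀ x, eLpNorm (φ x - ψ) 2 μ = (∫⁻ y, ‖φ x y - ψ y‖ₑ ^ (2:ℝ) ∂μ) ^ (1 / (2:ℝ)) := by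
    intro x
    rw [eLpNorm_eq_lintegral_rpow_enorm_toReal two_ne_zero ENNReal.ofNat_ne_top]
    simp
  simp_rw [e]
  have h : Filter.Tendsto (fun x => ∫⁻ y, ‖φ x y - ψ y‖ₑ ^ (2:ℝ) ∂μ) l (nhds (∫⁻ y, 0 ∂μ)) := by
    refine tendsto_lintegral_filter_of_dominated_convergence' (fun _ => ENNReal.ofReal B ^ (2:ℝ)) ?_ ?_ ?_ ?_
    · exact Filter.Eventually.of_forall fun x =>
        (((hφ x).1.sub hψ.1).enorm).pow_const _
    · filter_upwards [hb] with x hx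
      filter_upwards [hx] with y hy
      gcongr
      rw [← ofReal_norm]
      exact ENNReal.ofReal_le_ofReal hy
    · rw [lintegral_const]
      exact ENNReal.mul_ne_top (by simp) (measure_ne_top _ _)
    · filter_upwards [hlim] with y hy
      have h1 : Filter.Tendsto (fun x => ‖φ x y - ψ y‖ₑ) l (nhds 0) := by
        have := (hy.sub_const (ψ y)).enorm
        simpa using this
      have := h1.ennrpow_const (2:ℝ)
      simpa using this
  have := h.ennrpow_const (1 / (2:ℝ))
  simpa using this

lemma L2_C1 (f d : ℝ → ℂ) (A : ℝ) (hA : 0 ≤ A) (hf : Continuous f)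
    (hd : ∀ t, t ≠ 0 → HasDerivAt f (d t) t) (hdc : ∀ t, t ≠ 0 → ContinuousAt d t)
    (hdm : Measurable d) (hdb : ∀ t, ‖d t‖ ≤ A * (1 + |t|))
    (hlip : ∀ T a b, |a| ≤ T → |b| ≤ T → ‖f a - f b‖ ≤ A * (1 + T) * |a - b|)
    (X : ℝ) (hX : 0 ≤ X) :
    ∃ G : ℝ → Lp ℂ 2 (volume.restrict (Icc (0:ℝ) X)),
      (∀ x, ⇑(G x) =ᵐ[volume.restrict (Icc (0:ℝ) X)] fun y => f (x + y) - f (x - y)) ∧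
      ContDiff ℝ 1 G ∧ ∀ x ∈ Icc (0:ℝ) X, ‖deriv G x‖ ≤
        (measureUnivNNReal (volume.restrict (Icc (0:ℝ) X))) ^ (2 : ENNReal).toReal⁻¹ *
          (2 * (A * (1 + 2 * X))) := by
  set μ := volume.restrict (Icc (0:ℝ) X) with hμ
  have aeI : ∀ {p : ℝ → Prop}, (∀ y, 0 ≤ y → y ≤ X → p y) → ∀ᵐ y ∂μ, p y := by
    intro p h
    exact (ae_restrict_iff' measurableSet_Icc).2 (Filter.Eventually.of_forall fun y hy => h y hy.1 hy.2)
  have hne : ∀ x : ℝ, ∀ᵐ y ∂μ, x + y ≠ 0 ∧ x - y ≠ 0 := by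
    intro x
    apply ae_restrict_of_ae
    have h1 : ∀ᵐ y : ℝ, y ≠ x := by simp [ae_iff]
    have h2 : ∀ᵐ y : ℝ, y ≠ -x := by simp [ae_iff]
    filter_upwards [h1, h2] with y a b
    exact ⟨fun h => b (by linarith), fun h => a (by linarith)⟩
  -- bounds
  have fb : ∀ x y, 0 ≤ y → y ≤ X → |x + y| ≤ |x| + X ∧ |x - y| ≤ |x| + X := by
    intro x y h0 h1
    have a1 := abs_add_le x y
    have a2 := abs_sub x y
    rw [abs_of_nonneg h0] at a1 a2
    constructor <;> linarith
  have gb : ∀ x y, 0 ≤ y → y ≤ X → ‖d (x + y) - d (x - y)‖ ≤ 2 * (A * (1 + (|x| + X))) := by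
    intro x y h0 h1
    obtain ⟨c1, c2⟩ := fb x y h0 h1
    have b1 : A * (1 + |x + y|) ≤ A * (1 + (|x| + X)) := by gcongr
    have b2 : A * (1 + |x - y|) ≤ A * (1 + (|x| + X)) := by gcongr
    have := norm_sub_le (d (x + y)) (d (x - y))
    linarith [hdb (x + y), hdb (x - y)]
  have hF : ∀ x, MemLp (fun y => f (x + y) - f (x - y)) 2 μ := by
    intro x
    refine MemLp.of_bound (C := A * (1 + (|x| + X)) * (2 * X)) ?_ (aeI fun y h0 h1 => ?_)
    · exact Continuous.aestronglyMeasurable (by fun_prop)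
    · obtain ⟨c1, c2⟩ := fb x y h0 h1
      refine (hlip _ _ _ c1 c2).trans ?_
      have : |x + y - (x - y)| ≤ 2 * X := by
        rw [show x + y - (x - y) = 2 * y by ring, abs_of_nonneg (by linarith)]; linarith
      gcongr
  have hD : ∀ x, MemLp (fun y => d (x + y) - d (x - y)) 2 μ := by
    intro x
    refine MemLp.of_bound (C := 2 * (A * (1 + (|x| + X)))) ?_ (aeI fun y h0 h1 => gb x y h0 h1)
    exact Measurable.aestronglyMeasurable (by fun_prop)
  have near : ∀ x : ℝ, ∀ᶠ z in nhds x, |z| ≤ |x| + 1 := by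
    intro x
    filter_upwards [Metric.ball_mem_nhds x one_pos] with z hz
    rw [Metric.mem_ball, Real.dist_eq] at hz
    have := abs_sub_abs_le_abs_sub z x
    linarith
  have hder : ∀ x, HasDerivAt (fun x => (hF x).toLp _) ((hD x).toLp _) x := by
    intro x
    rw [hasDerivAt_iff_tendsto_slope]
    have hS : ∀ z, MemLp (fun y => ((z - x)⁻¹ : ℝ) • ((f (z + y) - f (z - y)) - (f (x + y) - f (x - y)))) 2 μ :=
      fun z => ((hF z).sub (hF x)).const_smul ((z - x)⁻¹ : ℝ)
    have e : slope (fun x => (hF x).toLp _) x = fun z => (hS z).toLp _ := by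
      funext z
      rw [slope_def_module]
      rw [← MemLp.toLp_sub, ← MemLp.toLp_const_smul]
      rfl
    rw [e]
    refine L2_tendsto _ _ hS (hD x) (2 * (A * (1 + (|x| + 1 + X))) + 2 * (A * (1 + (|x| + X)))) ?_ ?_
    · filter_upwards [nhdsWithin_le_nhds (near x), self_mem_nhdsWithin] with z hz hzx
      refine aeI fun y h0 h1 => (norm_sub_le _ _).trans (add_le_add ?_ (gb x y h0 h1))
      have hzx' : 0 < |z - x| := abs_pos.2 (sub_ne_zero.2 hzx)
      obtain ⟨c1, c2⟩ := fb x y h0 h1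
      obtain ⟨c3, c4⟩ := fb z y h0 h1
      have l1 := hlip (|x| + 1 + X) (z + y) (x + y) (by linarith) (by linarith)
      have l2 := hlip (|x| + 1 + X) (z - y) (x - y) (by linarith) (by linarith)
      rw [show z + y - (x + y) = z - x by ring] at l1
      rw [show z - y - (x - y) = z - x by ring] at l2
      rw [norm_smul, norm_inv, Real.norm_eq_abs, inv_mul_le_iff₀ hzx']
      rw [show f (z + y) - f (z - y) - (f (x + y) - f (x - y)) =
        (f (z + y) - f (x + y)) - (f (z - y) - f (x - y)) by ring]
      have := norm_sub_le (f (z + y) - f (x + y)) (f (z - y) - f (x - y))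
      linarith
    · filter_upwards [hne x] with y hy
      have h1 := (hd _ hy.1).comp_add_const x y
      have h2 := (hd _ hy.2).comp_sub_const x y
      have h3 := hasDerivAt_iff_tendsto_slope.1 (h1.sub h2)
      refine h3.congr fun z => ?_
      rw [slope_def_module]
      rfl
  have hcont : Continuous (fun x => (hD x).toLp (fun y => d (x + y) - d (x - y))) := by
    rw [continuous_iff_continuousAt]
    intro x
    refine L2_tendsto (fun x y => d (x + y) - d (x - y)) _ hD (hD x)
      (2 * (A * (1 + (|x| + 1 + X))) + 2 * (A * (1 + (|x| + X)))) ?_ ?_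
    · filter_upwards [near x] with z hz
      refine aeI fun y h0 h1 => (norm_sub_le _ _).trans (add_le_add ((gb z y h0 h1).trans ?_) (gb x y h0 h1))
      gcongr
    · filter_upwards [hne x] with y hy
      have h1 : ContinuousAt (fun z => d (z + y)) x :=
        ContinuousAt.comp (f := fun z => z + y) (hdc _ hy.1) (by fun_prop)
      have h2 : ContinuousAt (fun z => d (z - y)) x :=
        ContinuousAt.comp (f := fun z => z - y) (hdc _ hy.2) (by fun_prop)
      exact (h1.sub h2)
  refine ⟨fun x => (hF x).toLp _, fun x => (hF x).coeFn_toLp, ?_, ?_⟩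
  · rw [contDiff_one_iff_deriv]
    refine ⟨fun x => (hder x).differentiableAt, ?_⟩
    rw [show deriv (fun x => (hF x).toLp _) = _ from funext fun x => (hder x).deriv]
    exact hcont
  · intro x hx
    rw [(hder x).deriv]
    refine Lp.norm_le_of_ae_bound (by positivity) ?_
    filter_upwards [(hD x).coeFn_toLp, aeI fun y h0 h1 => gb x y h0 h1] with y h1 h2
    rw [h1]
    refine h2.trans ?_
    rw [abs_of_nonneg hx.1]
    have := hx.2
    gcongr
    linarith

def fd (w : ℂ) (t : ℝ) : ℂ := w / 2 * cc * ((t / |t| : ℝ) : ℂ) + RD w t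

lemma ff_deriv (w : ℂ) (hw : 0 < w.re) (t : ℝ) (ht : t ≠ 0) : HasDerivAt (ff w) (fd w t) t := by
  have h : HasDerivAt (fun t : ℝ => |t|) (t / |t|) t := by
    rcases lt_or_gt_of_ne ht with h | h
    · have := hasDerivAt_abs_neg h
      rwa [abs_of_neg h, div_neg, div_self ht]
    · have := hasDerivAt_abs_pos h
      rwa [abs_of_pos h, div_self ht]
  exact ((h.ofReal_comp).const_mul _).add (RR_deriv w hw t)

lemma fd_cont (w : ℂ) (hw : 0 < w.re) (t : ℝ) (ht : t ≠ 0) : ContinuousAt (fd w) t := by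
  have h1 := (RD_cont w hw).continuousAt (x := t)
  have h2 : ContinuousAt (fun t : ℝ => t / |t|) t :=
    continuousAt_id.div continuous_abs.continuousAt (by simpa using ht)
  have h3 : ContinuousAt (fun t : ℝ => ((t / |t| : ℝ) : ℂ)) t :=
    Complex.continuous_ofReal.continuousAt.comp h2
  exact (continuousAt_const.mul h3).add h1

lemma fd_meas (w : ℂ) (hw : 0 < w.re) : Measurable (fd w) := by
  have h1 := (RD_cont w hw).measurable
  unfold fd
  fun_prop

def AA (w : ℂ) : ℝ := (1 + ‖w‖) ^ 2 * (|cc| + KK)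

lemma AA_nonneg (w : ℂ) : 0 ≤ AA w := by
  have := KK_nonneg
  unfold AA
  positivity

lemma wcc (w : ℂ) : ‖w / 2 * (cc : ℂ)‖ ≤ (1 + ‖w‖) ^ 2 * |cc| := by
  rw [norm_mul, Complex.norm_real, Real.norm_eq_abs, norm_div]
  simp only [Complex.norm_ofNat]
  gcongr
  nlinarith [norm_nonneg w]

lemma fd_bound (w : ℂ) (hw : 0 < w.re) (t : ℝ) : ‖fd w t‖ ≤ AA w * (1 + |t|) := by
  have h1 := RD_norm w hw t
  have h2 : ‖w / 2 * (cc : ℂ) * ((t / |t| : ℝ) : ℂ)‖ ≤ (1 + ‖w‖) ^ 2 * |cc| * 1 := by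
    rw [norm_mul]
    apply mul_le_mul (wcc w) _ (norm_nonneg _) (by positivity)
    rw [Complex.norm_real, Real.norm_eq_abs, abs_div, abs_abs]
    exact div_self_le_one _
  refine (norm_add_le _ _).trans ((add_le_add h2 h1).trans ?_)
  unfold AA
  have := KK_nonneg
  have e1 : 0 ≤ (1 + ‖w‖) ^ 2 * |cc| * |t| := by positivity
  have e2 : 0 ≤ (1 + ‖w‖) ^ 2 * KK := by positivity
  nlinarith

lemma RR_lip (w : ℂ) (hw : 0 < w.re) (T a b : ℝ) (ha : |a| ≤ T) (hb : |b| ≤ T) :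
    ‖RR w a - RR w b‖ ≤ (T * (1 + ‖w‖) ^ 2 * KK) * |a - b| := by
  have := KK_nonneg
  refine Convex.norm_image_sub_le_of_norm_hasDerivWithin_le (s := Icc (-T) T) (f' := RD w)
    (fun t _ => (RR_deriv w hw t).hasDerivWithinAt) (fun t ht => ?_) (convex_Icc _ _)
    (abs_le.1 hb) (abs_le.1 ha)
  refine (RD_norm w hw t).trans ?_
  have := abs_le.2 ht
  gcongr

lemma ff_lip (w : ℂ) (hw : 0 < w.re) (T a b : ℝ) (ha : |a| ≤ T) (hb : |b| ≤ T) :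
    ‖ff w a - ff w b‖ ≤ AA w * (1 + T) * |a - b| := by
  have h1 := RR_lip w hw T a b ha hb
  have h2 : ‖w / 2 * (cc : ℂ) * ((|a| - |b| : ℝ) : ℂ)‖ ≤ (1 + ‖w‖) ^ 2 * |cc| * |a - b| := by
    rw [norm_mul]
    apply mul_le_mul (wcc w) _ (norm_nonneg _) (by positivity)
    rw [Complex.norm_real, Real.norm_eq_abs]
    exact abs_abs_sub_abs_le a b
  have e : ff w a - ff w b = w / 2 * (cc : ℂ) * ((|a| - |b| : ℝ) : ℂ) + (RR w a - RR w b) := by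
    unfold ff; push_cast; ring
  rw [e]
  refine (norm_add_le _ _).trans ((add_le_add h2 h1).trans ?_)
  rw [← add_mul]
  unfold AA
  have := KK_nonneg
  have hT : 0 ≤ T := (abs_nonneg a).trans ha
  gcongr
  have e1 : 0 ≤ (1 + ‖w‖) ^ 2 * |cc| * T := by positivity
  have e2 : 0 ≤ (1 + ‖w‖) ^ 2 * KK := by positivity
  nlinarith

lemma ff_cont (w : ℂ) (hw : 0 < w.re) : Continuous (ff w) := by
  have : Continuous (RR w) := continuous_iff_continuousAt.2 fun t => (RR_deriv w hw t).continuousAt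
  unfold ff
  fun_prop

def dd (w : ℂ) (t : ℝ) : ℂ := (Real.pi : ℂ)⁻¹ * (w * cc + 2 * RD w (2 * t))

lemma diag_deriv (w : ℂ) (hw : 0 < w.re) (t : ℝ) (ht : 0 ≤ t) :
    HasDerivWithinAt (fun t : ℝ => Phi t t w) (dd w t) (Ici 0) t := by
  have h1 : HasDerivAt (fun t : ℝ => RR w (2 * t)) (2 * RD w (2 * t)) t := by
    have := (RR_deriv w hw (2 * t)).scomp t ((hasDerivAt_id t).const_mul 2)
    refine this.congr_deriv ?_
    simp
  have h2 : HasDerivAt (fun t : ℝ => w * cc * (t : ℂ)) (w * cc) t := by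
    simpa using ((hasDerivAt_id t).ofReal_comp).const_mul (w * (cc : ℂ))
  have h3 := (((h2.add h1).sub_const (RR w 0)).const_mul ((Real.pi : ℂ)⁻¹)).hasDerivWithinAt (s := Ici 0)
  have key : ∀ s ∈ Ici (0:ℝ), Phi s s w = (Real.pi : ℂ)⁻¹ * (w * cc * (s : ℂ) + RR w (2 * s) - RR w 0) := by
    intro s hs
    rw [Phi_eq w hw]
    unfold ff
    have : (0:ℝ) ≤ s := hs
    rw [sub_self, abs_zero, abs_of_nonneg (by linarith), ← two_mul]
    push_cast
    ring
  exact h3.congr key (key t ht)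

lemma dd_cont (w : ℂ) (hw : 0 < w.re) : Continuous (dd w) := by
  have := RD_cont w hw
  unfold dd
  fun_prop

lemma pi_inv_le : ‖(Real.pi : ℂ)⁻¹‖ ≤ 1 := by
  rw [norm_inv, Complex.norm_real, Real.norm_eq_abs, abs_of_pos Real.pi_pos]
  exact inv_le_one_of_one_le₀ (by linarith [Real.pi_gt_three])

lemma dd_norm (w : ℂ) (hw : 0 < w.re) (t : ℝ) :
    ‖dd w t‖ ≤ (2 * |cc| + 4 * |t| * KK) * (1 + ‖w‖) ^ 2 := by
  unfold dd
  rw [norm_mul]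
  have h1 := RD_norm w hw (2 * t)
  have h2 := wcc w
  have h3 := norm_add_le (w * (cc : ℂ)) (2 * RD w (2 * t))
  have h4 : ‖w * (cc : ℂ)‖ = 2 * ‖w / 2 * (cc : ℂ)‖ := by
    rw [norm_mul, norm_mul, norm_div]; simp only [Complex.norm_ofNat]; ring
  have h5 : ‖2 * RD w (2 * t)‖ = 2 * ‖RD w (2 * t)‖ := by simp
  rw [abs_mul, abs_two] at h1
  calc _ ≤ 1 * ‖w * (cc : ℂ) + 2 * RD w (2 * t)‖ := by gcongr; exact pi_inv_le
    _ ≤ _ := by nlinarith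

/-- **Regularity and polynomial estimates for the kernel `Φ`.**
(i) `Φ` is continuous in `(x,y) ∈ [0,∞)²` and holomorphic in `w ∈ {Re w > 0}`;
(ii) for `X ≥ 1`, `x ↦ Φ(x,·,w) ∈ L²([0,X])` is continuously differentiable;
(iii) `x ↦ Φ(x,x,w)` is continuously differentiable on `[0,∞)`;
(iv) all of `Φ`, its `L²`-valued `x`-derivative, and `d/dx Φ(x,x,w)` are bounded by
`C(X)(1+|w|)^α` with `α` independent of `X`. -/
theorem stmt_12 :
    -- (i) joint continuity in (x,y) and holomorphy in w
    (∀ w : ℂ, 0 < w.re →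
      ContinuousOn (fun p : ℝ × ℝ => Phi p.1 p.2 w) (Ici 0 ×ˢ Ici 0)) ∧
    (∀ x ≥ (0:ℝ), ∀ y ≥ (0:ℝ),
      DifferentiableOn ℂ (fun w => Phi x y w) {w : ℂ | 0 < w.re}) ∧
    -- (iii) continuous differentiability of the diagonal map x ↦ Φ(x,x,w)
    (∀ w : ℂ, 0 < w.re →
      (∀ x ∈ Ici (0:ℝ),
        DifferentiableWithinAt ℝ (fun t : ℝ => Phi t t w) (Ici 0) x) ∧
      ContinuousOn (fun x : ℝ => derivWithin (fun t : ℝ => Phi t t w) (Ici 0) x)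
        (Ici 0)) ∧
    -- (ii) and (iv) : C¹ regularity of x ↦ Φ(x,·,w) ∈ L²([0,X]) and polynomial bounds
    ∃ α : ℝ, 0 ≤ α ∧ ∀ X : ℝ, 1 ≤ X → ∃ C : ℝ, 0 < C ∧ ∀ w : ℂ, 0 < w.re →
      (∃ G : ℝ → Lp ℂ 2 (volume.restrict (Icc (0:ℝ) X)),
        (∀ x ∈ Icc (0:ℝ) X,
          ⇑(G x) =ᵐ[volume.restrict (Icc (0:ℝ) X)] fun y => Phi x y w) ∧
        ContDiffOn ℝ 1 G (Icc 0 X) ∧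
        ∀ x ∈ Icc (0:ℝ) X, ‖derivWithin G (Icc 0 X) x‖ ≤ C * (1 + ‖w‖) ^ α) ∧
      (∀ x ∈ Icc (0:ℝ) X, ∀ y ∈ Icc (0:ℝ) X, ‖Phi x y w‖ ≤ C * (1 + ‖w‖) ^ α) ∧
      (∀ x ∈ Icc (0:ℝ) X,
        ‖derivWithin (fun t : ℝ => Phi t t w) (Ici 0) x‖ ≤ C * (1 + ‖w‖) ^ α) := by
  refine ⟨fun w hw => ?_, fun x _ y _ w hw => (Phi_diff w hw x y).differentiableWithinAt,
    fun w hw => ⟨fun x hx => (diag_deriv w hw x hx).differentiableWithinAt, ?_⟩, 2, by norm_num,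
    fun X hX => ?_⟩
  · have h := ff_cont w hw
    simp_rw [Phi_eq w hw]
    apply Continuous.continuousOn
    fun_prop
  · refine (dd_cont w hw).continuousOn.congr fun x hx => ?_
    exact (diag_deriv w hw x hx).derivWithin (uniqueDiffOn_Ici 0 x hx)
  have hK := KK_nonneg
  set V : ℝ := (measureUnivNNReal (volume.restrict (Icc (0:ℝ) X))) ^ (2 : ENNReal).toReal⁻¹ with hV
  have hV0 : 0 ≤ V := by positivity
  have hX0 : 0 ≤ X := by linarith
  set C1 : ℝ := V * (2 * ((|cc| + KK) * (1 + 2 * X))) with hC1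
  set C2 : ℝ := (1 + X * X) * KK with hC2
  set C3 : ℝ := 2 * |cc| + 4 * X * KK with hC3
  have p1 : 0 ≤ C1 := by positivity
  have p2 : 0 ≤ C2 := by positivity
  have p3 : 0 ≤ C3 := by positivity
  refine ⟨1 + C1 + C2 + C3, by positivity, fun w hw => ?_⟩
  rw [Real.rpow_two]
  refine ⟨?_, ?_, ?_⟩
  · have hpi := pi_inv_le
    obtain ⟨G, hG, hG1, hG2⟩ := L2_C1 (fun t => (Real.pi : ℂ)⁻¹ * ff w t)
      (fun t => (Real.pi : ℂ)⁻¹ * fd w t) (AA w) (AA_nonneg w)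
      (continuous_const.mul (ff_cont w hw)) (fun t ht => (ff_deriv w hw t ht).const_mul _)
      (fun t ht => continuousAt_const.mul (fd_cont w hw t ht))
      ((fd_meas w hw).const_mul _)
      (fun t => by
        rw [norm_mul]
        calc _ ≤ 1 * ‖fd w t‖ := by gcongr
          _ ≤ _ := by rw [one_mul]; exact fd_bound w hw t)
      (fun T a b ha hb => by
        rw [← mul_sub, norm_mul]
        calc _ ≤ 1 * ‖ff w a - ff w b‖ := by gcongr
          _ ≤ _ := by rw [one_mul]; exact ff_lip w hw T a b ha hb) X hX0
    refine ⟨G, fun x _ => (hG x).trans (Filter.Eventually.of_forall fun y => ?_),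
      hG1.contDiffOn, fun x hx => ?_⟩
    · simp only
      rw [Phi_eq w hw, mul_sub]
    · have hdG : DifferentiableAt ℝ G x := hG1.differentiable (by norm_num) x
      rw [hdG.derivWithin (uniqueDiffOn_Icc (by linarith) x hx)]
      refine (hG2 x hx).trans ?_
      calc _ = C1 * (1 + ‖w‖) ^ 2 := by rw [hC1, hV]; unfold AA; ring
        _ ≤ _ := by gcongr; linarith
  · intro x hx y hy
    refine (Phi_norm w hw x y).trans ?_
    rw [abs_of_nonneg hx.1, abs_of_nonneg hy.1]
    have h1 : x * y ≤ X * X := mul_le_mul hx.2 hy.2 hy.1 hX0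
    have h2 : ‖w‖ ≤ (1 + ‖w‖) ^ 2 := by nlinarith [norm_nonneg w]
    calc _ ≤ (1 + X * X) * (1 + ‖w‖) ^ 2 * KK := by gcongr
      _ = C2 * (1 + ‖w‖) ^ 2 := by rw [hC2]; ring
      _ ≤ _ := by gcongr; linarith
  · intro x hx
    rw [(diag_deriv w hw x hx.1).derivWithin (uniqueDiffOn_Ici 0 x hx.1)]
    refine (dd_norm w hw x).trans ?_
    rw [abs_of_nonneg hx.1]
    have := hx.2
    calc _ ≤ C3 * (1 + ‖w‖) ^ 2 := by rw [hC3]; gcongr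
      _ ≤ _ := by gcongr; linarith

end
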